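/- Let a < b and λ ∈ (a, b), write mγ := √((λ−a)(b−λ)), and set h = 1/√((λ−a)(b−λ)). Then lim_{p→0⁺} [ ∫_a^{λ−p} dE/√((E−a)(b−E)((E−λ)²−p²)) − h·ln(1/p) ] exists and equals h·ln(8(mγ)²/(b−a)). -/

import Mathlib

open Set

theorem integral_mul_bounds_of_hasDerivAt {f s G : ℝ → ℝ} {α β C S : ℝ} (hαβ : α ≤ β)
    (hC : 0 < C) (hf : Measurable f) (hf0 : ∀ x, 0 ≤ f x)
    (hs : ∀ x ∈ Ioo α β, 1 ≤ s x ∧ s x ≤ S) (hG : ContinuousOn G (Icc α β))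
    (hG' : ∀ x ∈ Ioo α β, HasDerivAt G (C * f x * s x) x) :
    IntervalIntegrable f MeasureTheory.volume α β ∧
      C * (∫ x in α..β, f x) ≤ G β - G α ∧ G β - G α ≤ S * (C * ∫ x in α..β, f x) := by
  have hCf : ∀ x ∈ Ioo α β, C * f x ≤ C * f x * s x := fun x hx =>
    le_mul_of_one_le_right (mul_nonneg hC.le (hf0 x)) (hs x hx).1
  have hint : IntervalIntegrable (fun x => C * f x * s x) MeasureTheory.volume α β := by
    rw [intervalIntegrable_iff_integrableOn_Ioc_of_le hαβ]
    exact intervalIntegral.integrableOn_deriv_of_nonneg hG hG' fun x hx =>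
      (mul_nonneg hC.le (hf0 x)).trans (hCf x hx)
  have hCfi : IntervalIntegrable (fun x => C * f x) MeasureTheory.volume α β := by
    rw [intervalIntegrable_iff_integrableOn_Ioo_of_le hαβ] at hint ⊢
    refine hint.mono' (hf.const_mul C).aestronglyMeasurable ?_
    filter_upwards [MeasureTheory.ae_restrict_mem measurableSet_Ioo] with x hx
    rw [Real.norm_of_nonneg (mul_nonneg hC.le (hf0 x))]
    exact hCf x hx
  have hfi : IntervalIntegrable f MeasureTheory.volume α β := by
    simpa [hC.ne'] using hCfi.const_mul C⁻¹
  have hFTC := intervalIntegral.integral_eq_sub_of_hasDerivAt_of_le hαβ hG hG' hint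
  refine ⟨hfi, ?_, ?_⟩
  · rw [← hFTC, ← intervalIntegral.integral_const_mul]
    exact intervalIntegral.integral_mono_on_of_le_Ioo hαβ hCfi hint hCf
  · rw [← hFTC, ← intervalIntegral.integral_const_mul, ← intervalIntegral.integral_const_mul]
    refine intervalIntegral.integral_mono_on_of_le_Ioo hαβ hint (hCfi.const_mul S) fun x hx => ?_
    rw [mul_comm S]
    exact mul_le_mul_of_nonneg_left (hs x hx).2 (mul_nonneg hC.le (hf0 x))

theorem HasDerivAt.two_mul_arsinh_sqrt {v : ℝ → ℝ} {v' x : ℝ} (hv : HasDerivAt v v' x)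
    (hx : 0 < v x) :
    HasDerivAt (fun y => 2 * Real.arsinh √(v y)) (v' / √(v x * (1 + v x))) x := by
  refine ((hv.sqrt hx.ne').arsinh.const_mul 2).congr_deriv ?_
  rw [Real.sq_sqrt hx.le, Real.sqrt_mul hx.le, smul_eq_mul]
  have := Real.sqrt_pos.2 hx
  have : 0 < √(1 + v x) := Real.sqrt_pos.2 (by linarith)
  field_simp

theorem quartic_integral_bounds {a q r b k C : ℝ} (haq : a < q) (hqr : q < r) (hrb : r < b)
    (hC : 0 < C) (hC2 : C ^ 2 = (b - q) * (r - a)) (hk : 0 < k)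
    (hk2 : k ^ 2 * C ^ 2 = (r - q) * (b - a)) :
    C * (∫ E in a..q, 1 / √((E - a) * (b - E) * ((q - E) * (r - E)))) ≤
        4 * Real.arsinh √(1 / k) ∧
      4 * Real.arsinh √(1 / k) ≤ (1 + k) *
        (C * ∫ E in a..q, 1 / √((E - a) * (b - E) * ((q - E) * (r - E)))) := by
  have hra : 0 < r - a := by linarith
  have hrq : 0 < r - q := by linarith
  have hbq : 0 < b - q := by linarith
  have hba : 0 < b - a := by linarith
  have hqa : 0 < q - a := by linarith
  set f : ℝ → ℝ := fun E => 1 / √((E - a) * (b - E) * ((q - E) * (r - E))) with hf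
  have hfm : Measurable f := by fun_prop
  have hf0 : ∀ x, 0 ≤ f x := fun x => by positivity
  have hS : ∀ θ, 0 ≤ θ → θ ≤ k → 1 ≤ √(1 + θ) ∧ √(1 + θ) ≤ 1 + k := fun θ h0 h1 =>
    ⟨Real.one_le_sqrt.2 (by linarith), Real.sqrt_le_iff.2 ⟨by linarith, by nlinarith⟩⟩
  obtain ⟨c, hac, hcq, hc⟩ : ∃ c, a < c ∧ c < q ∧ k * (r - a) * (q - c) = (r - q) * (c - a) := by
    have hd : 0 < k * (r - a) + (r - q) := by positivity
    refine ⟨(k * (r - a) * q + (r - q) * a) / (k * (r - a) + (r - q)), ?_, ?_, ?_⟩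
    · rw [lt_div_iff₀ hd]; nlinarith [mul_pos (mul_pos hk hra) hqa]
    · rw [div_lt_iff₀ hd]; nlinarith [mul_pos hrq hqa]
    · field_simp; ring
  have hc' : k * (b - q) * (c - a) = (b - a) * (q - c) := by
    have : k * (r - q) * (k * (b - q) * (c - a)) = k * (r - q) * ((b - a) * (q - c)) := by
      rw [hC2] at hk2
      linear_combination (-k ^ 2 * (b - q)) * hc + k * (q - c) * hk2
    exact mul_left_cancel₀ (by positivity) this
  set w : ℝ → ℝ := fun E => (b - q) * (E - a) / ((b - a) * (q - E)) with hw
  set v : ℝ → ℝ := fun E => (r - a) * (q - E) / ((r - q) * (E - a)) with hv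
  have hleft := integral_mul_bounds_of_hasDerivAt (f := f) (S := 1 + k)
    (s := fun E => √(1 + (r - q) * (E - a) / ((r - a) * (q - E))))
    (G := fun E => 2 * Real.arsinh √(w E)) hac.le hC hfm hf0
    (fun x hx => by
      have h1 : 0 < x - a := by linarith [hx.1]
      have h2 : 0 < q - x := by linarith [hx.2]
      refine hS _ (by positivity) ?_
      rw [div_le_iff₀ (by positivity)]
      nlinarith [hx.2, mul_pos hk hra])
    (by
      have : ContinuousOn w (Icc a c) := by
        refine ContinuousOn.div (by fun_prop) (by fun_prop) fun x hx => ?_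
        have h2 : 0 < q - x := by linarith [hx.2]
        positivity
      exact (Real.continuous_arsinh.comp_continuousOn this.sqrt).const_smul (2 : ℝ))
    (fun x hx => by
      have h1 : 0 < x - a := by linarith [hx.1]
      have h2 : 0 < q - x := by linarith [hx.2]
      have h3 : 0 < r - x := by linarith
      have h4 : 0 < b - x := by linarith
      have hw' : HasDerivAt w ((b - q) * (q - a) / ((b - a) * (q - x) ^ 2)) x := by
        refine HasDerivAt.congr_deriv ((((hasDerivAt_id x).sub_const a).const_mul (b - q)).div
          (((hasDerivAt_id x).const_sub q).const_mul (b - a)) (ne_of_gt (by positivity))) ?_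
        dsimp only [id]
        field_simp
        ring
      have hwx : 0 < w x := by simp only [hw]; positivity
      refine (hw'.two_mul_arsinh_sqrt hwx).congr_deriv (Eq.symm ?_)
      rw [← pow_left_inj₀ (by positivity) (by positivity) two_ne_zero]
      simp only [hf, mul_pow, div_pow]
      rw [Real.sq_sqrt (by positivity), Real.sq_sqrt (by positivity), Real.sq_sqrt (by positivity),
        hC2]
      have e1 : 1 + w x = (q - a) * (b - x) / ((b - a) * (q - x)) := by
        simp only [hw]; field_simp; ring
      have e2 : 1 + (r - q) * (x - a) / ((r - a) * (q - x))
          = (q - a) * (r - x) / ((r - a) * (q - x)) := by field_simp; ring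
      rw [e1, e2]
      simp only [hw]
      field_simp)
  have hright := integral_mul_bounds_of_hasDerivAt (f := f) (S := 1 + k)
    (s := fun E => √(1 + (b - a) * (q - E) / ((b - q) * (E - a))))
    (G := fun E => -(2 * Real.arsinh √(v E))) hcq.le hC hfm hf0
    (fun x hx => by
      have h1 : 0 < x - a := by linarith [hx.1]
      have h2 : 0 < q - x := by linarith [hx.2]
      refine hS _ (by positivity) ?_
      rw [div_le_iff₀ (by positivity)]
      nlinarith [hx.1, mul_pos hk hbq])
    (by
      have : ContinuousOn v (Icc c q) := by
        refine ContinuousOn.div (by fun_prop) (by fun_prop) fun x hx => ?_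
        have h1 : 0 < x - a := by linarith [hx.1]
        positivity
      exact ((Real.continuous_arsinh.comp_continuousOn this.sqrt).const_smul (2 : ℝ)).neg)
    (fun x hx => by
      have h1 : 0 < x - a := by linarith [hx.1]
      have h2 : 0 < q - x := by linarith [hx.2]
      have h3 : 0 < r - x := by linarith
      have h4 : 0 < b - x := by linarith
      have hv' : HasDerivAt v (-((r - a) * (q - a) / ((r - q) * (x - a) ^ 2))) x := by
        refine HasDerivAt.congr_deriv ((((hasDerivAt_id x).const_sub q).const_mul (r - a)).div
          (((hasDerivAt_id x).sub_const a).const_mul (r - q)) (ne_of_gt (by positivity))) ?_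
        dsimp only [id]
        field_simp
        ring
      have hvx : 0 < v x := by simp only [hv]; positivity
      refine (hv'.two_mul_arsinh_sqrt hvx).neg.congr_deriv (Eq.symm ?_)
      rw [neg_div, neg_neg, ← pow_left_inj₀ (by positivity) (by positivity) two_ne_zero]
      simp only [hf, mul_pow, div_pow]
      rw [Real.sq_sqrt (by positivity), Real.sq_sqrt (by positivity), Real.sq_sqrt (by positivity),
        hC2]
      have e1 : 1 + v x = (q - a) * (r - x) / ((r - q) * (x - a)) := by
        simp only [hv]; field_simp; ring
      have e2 : 1 + (b - a) * (q - x) / ((b - q) * (x - a))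
          = (q - a) * (b - x) / ((b - q) * (x - a)) := by field_simp; ring
      rw [e1, e2]
      simp only [hv]
      field_simp)
  have hca : 0 < c - a := by linarith
  have hqc : 0 < q - c := by linarith
  have hwc : w c = 1 / k := by
    simp only [hw]; rw [div_eq_div_iff (by positivity) (by positivity)]; linarith
  have hvc : v c = 1 / k := by
    simp only [hv]; rw [div_eq_div_iff (by positivity) (by positivity)]; linarith
  have hwa : w a = 0 := by simp [hw]
  have hvq : v q = 0 := by simp [hv]
  simp only [hwc, hwa, hvc, hvq, Real.sqrt_zero, Real.arsinh_zero] at hleft hright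
  obtain ⟨i1, l1, u1⟩ := hleft
  obtain ⟨i2, l2, u2⟩ := hright
  rw [← intervalIntegral.integral_add_adjacent_intervals i1 i2]
  constructor <;> nlinarith

theorem four_mul_arsinh_sqrt_inv {k : ℝ} (hk : 0 < k) :
    4 * Real.arsinh √(1 / k) = 4 * Real.log (1 + √(1 + k)) - Real.log (k ^ 2) := by
  have h : √(1 / k) + √(1 + √(1 / k) ^ 2) = (1 + √(1 + k)) / √k := by
    rw [Real.sq_sqrt (by positivity), show 1 + 1 / k = (1 + k) / k by field_simp; ring,
      Real.sqrt_div (by positivity), Real.sqrt_div (by positivity), Real.sqrt_one]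
    ring
  rw [Real.arsinh, h, Real.log_div (by positivity) (by positivity), Real.log_sqrt hk.le,
    Real.log_pow]
  push_cast
  ring

theorem tendsto_mul_log_inv_of_hasDerivAt {φ : ℝ → ℝ} {φ' : ℝ} (hφ : HasDerivAt φ φ' 0) :
    Filter.Tendsto (fun p => (φ p - φ 0) * Real.log (1 / p)) (nhdsWithin 0 (Ioi 0)) (nhds 0) := by
  have h1 : Filter.Tendsto (fun p : ℝ => p * Real.log p) (nhdsWithin 0 (Ioi 0)) (nhds 0) := by
    simpa using (Real.continuous_mul_log.tendsto 0).mono_left nhdsWithin_le_nhds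
  have h2 := (hφ.tendsto_slope_zero_right.mul h1).neg
  rw [mul_zero, neg_zero] at h2
  refine h2.congr' ?_
  filter_upwards [self_mem_nhdsWithin] with p hp
  have hp : (0 : ℝ) < p := hp
  rw [one_div, Real.log_inv, zero_add, smul_eq_mul]
  field_simp

theorem tendsto_sqrt_mul_log_inv :
    Filter.Tendsto (fun p : ℝ => √p * Real.log (1 / p)) (nhdsWithin 0 (Ioi 0)) (nhds 0) := by
  have h1 : Filter.Tendsto (fun p : ℝ => -2 * (√p * Real.log √p)) (nhdsWithin 0 (Ioi 0))
      (nhds 0) := by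
    simpa using (((Real.continuous_mul_log.comp Real.continuous_sqrt).const_mul (-2)).tendsto
      0).mono_left nhdsWithin_le_nhds
  refine h1.congr' ?_
  filter_upwards [self_mem_nhdsWithin] with p hp
  rw [one_div, Real.log_inv, Real.log_sqrt (le_of_lt hp)]
  ring

/-- Small-gap asymptotics of the elliptic integral: the finite part of the
logarithmically divergent band integral equals h·ln(8(λ-a)(b-λ)/(b-a)). -/
theorem small_gap_integral_asymptotics (a b lam : ℝ) (hab : a < b)
    (h1 : a < lam) (h2 : lam < b) :
    let h : ℝ := 1 / Real.sqrt ((lam - a) * (b - lam))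
    Filter.Tendsto
      (fun p : ℝ =>
        (∫ E in a..(lam - p),
            1 / Real.sqrt ((E - a) * (b - E) * ((E - lam) ^ 2 - p ^ 2))) -
          h * Real.log (1 / p))
      (nhdsWithin 0 (Set.Ioi 0))
      (nhds (h * Real.log (8 * ((lam - a) * (b - lam)) / (b - a)))) := by
  intro h
  have hA : 0 < lam - a := by linarith
  have hB : 0 < b - lam := by linarith
  have hba : 0 < b - a := by linarith
  set P : ℝ → ℝ := fun p => (lam + p - a) * (b - (lam - p)) with hP
  have hP0 : P 0 = (lam - a) * (b - lam) := by simp [hP]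
  have hP0' : 0 < P 0 := by rw [hP0]; positivity
  have hPc : Continuous P := by fun_prop
  set φ : ℝ → ℝ := fun p => 1 / √(P p) with hφ
  have hφ0 : φ 0 = h := by simp only [hφ, hP0, h]
  set κ : ℝ → ℝ := fun p => √(2 * (b - a) / P p) with hκ
  set R : ℝ → ℝ := fun p => 4 * Real.log (1 + √(1 + √p * κ p)) - Real.log (2 * (b - a) / P p)
    with hR
  have hκc : ContinuousAt κ 0 := (continuousAt_const.div hPc.continuousAt hP0'.ne').sqrt
  have hφc : ContinuousAt φ 0 :=
    continuousAt_const.div hPc.continuousAt.sqrt (Real.sqrt_pos.2 hP0').ne'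
  have hsc : ContinuousAt (fun p : ℝ => √p) 0 := Real.continuous_sqrt.continuousAt
  have hRc : ContinuousAt R 0 := by
    refine ContinuousAt.sub (continuousAt_const.mul (ContinuousAt.log
      (continuousAt_const.add (continuousAt_const.add (hsc.mul hκc)).sqrt) (by positivity)))
      (ContinuousAt.log (continuousAt_const.div hPc.continuousAt hP0'.ne') (by positivity))
  have hR0 : R 0 = Real.log (8 * ((lam - a) * (b - lam)) / (b - a)) := by
    have : Real.log (16 : ℝ) = 4 * Real.log 2 := by
      rw [show (16 : ℝ) = 2 ^ 4 by norm_num, Real.log_pow]; norm_num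
    simp only [hR, Real.sqrt_zero, zero_mul, add_zero, Real.sqrt_one]
    rw [one_add_one_eq_two, ← this, ← Real.log_div (by norm_num) (by positivity), hP0]
    congr 1
    field_simp
    norm_num
  have hφd : DifferentiableAt ℝ φ 0 := by
    have hPd : DifferentiableAt ℝ P 0 := by fun_prop
    exact (differentiableAt_const _).div (hPd.sqrt hP0'.ne') (Real.sqrt_pos.2 hP0').ne'
  have lim {g : ℝ → ℝ} (hg : ContinuousAt g 0) :
      Filter.Tendsto g (nhdsWithin 0 (Ioi 0)) (nhds (g 0)) := hg.tendsto.mono_left nhdsWithin_le_nhds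
  have hU : Filter.Tendsto (fun p => φ p * R p + (φ p - φ 0) * Real.log (1 / p))
      (nhdsWithin 0 (Ioi 0)) (nhds (h * Real.log (8 * ((lam - a) * (b - lam)) / (b - a)))) := by
    simpa [hφ0, hR0] using
      ((lim hφc).mul (lim hRc)).add (tendsto_mul_log_inv_of_hasDerivAt hφd.hasDerivAt)
  have hE : Filter.Tendsto
      (fun p => φ p * (κ p * (√p * R p + √p * Real.log (1 / p)))) (nhdsWithin 0 (Ioi 0))
      (nhds 0) := by
    simpa using (lim hφc).mul ((lim hκc).mul
      (((lim hsc).mul (lim hRc)).add tendsto_sqrt_mul_log_inv))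
  have key : ∀ p ∈ Ioo 0 (min (lam - a) (b - lam)),
      φ p * R p + (φ p - φ 0) * Real.log (1 / p)
          - φ p * (κ p * (√p * R p + √p * Real.log (1 / p))) ≤
        (∫ E in a..(lam - p), 1 / √((E - a) * (b - E) * ((E - lam) ^ 2 - p ^ 2)))
          - h * Real.log (1 / p) ∧
      (∫ E in a..(lam - p), 1 / √((E - a) * (b - E) * ((E - lam) ^ 2 - p ^ 2)))
          - h * Real.log (1 / p) ≤
        φ p * R p + (φ p - φ 0) * Real.log (1 / p) := by
    rintro p ⟨hp, hp'⟩
    obtain ⟨hpA, hpB⟩ := lt_min_iff.1 hp'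
    have hPp : 0 < P p := mul_pos (by linarith) (by linarith)
    have hκp : 0 < κ p := Real.sqrt_pos.2 (by positivity)
    have hk : 0 < √p * κ p := by positivity
    have hk2 : (√p * κ p) ^ 2 = p * (2 * (b - a) / P p) := by
      rw [mul_pow, Real.sq_sqrt hp.le, Real.sq_sqrt (by positivity)]
    have hC : 0 < √(P p) := Real.sqrt_pos.2 hPp
    obtain ⟨hl, hu⟩ := quartic_integral_bounds (a := a) (q := lam - p) (r := lam + p) (b := b)
      (k := √p * κ p) (by linarith) (by linarith) (by linarith) hC
      (by rw [Real.sq_sqrt hPp.le]; ring) hk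
      (by rw [hk2, Real.sq_sqrt hPp.le]; field_simp; ring)
    have hT : 4 * Real.arsinh √(1 / (√p * κ p)) = R p + Real.log (1 / p) := by
      rw [four_mul_arsinh_sqrt_inv hk, hk2, Real.log_mul hp.ne' (by positivity), one_div,
        Real.log_inv]
      simp only [hR]
      ring
    have hint : ∀ E : ℝ, (lam - p - E) * (lam + p - E) = (E - lam) ^ 2 - p ^ 2 := fun E => by ring
    simp only [hint] at hl hu
    rw [hT] at hl hu
    set I := ∫ E in a..(lam - p), 1 / √((E - a) * (b - E) * ((E - lam) ^ 2 - p ^ 2))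
    have hφp : 0 < φ p := by positivity
    have hI : I = φ p * (√(P p) * I) := by simp only [hφ]; field_simp
    rw [hφ0, hI]
    generalize √(P p) * I = J at hl hu
    generalize Real.log (1 / p) = l at hl hu
    have h1 := mul_le_mul_of_nonneg_left hl hφp.le
    have h2 := mul_le_mul_of_nonneg_left
      (hu.trans (by nlinarith : _ ≤ J + √p * κ p * (R p + l))) hφp.le
    constructor <;> nlinarith
  have hev : Ioo 0 (min (lam - a) (b - lam)) ∈ nhdsWithin (0 : ℝ) (Ioi 0) :=
    Ioo_mem_nhdsGT (lt_min hA hB)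
  have hL := hU.sub hE
  rw [sub_zero] at hL
  refine tendsto_of_tendsto_of_tendsto_of_le_of_le' hL hU ?_ ?_
  · filter_upwards [hev] with p hp using (key p hp).1
  · filter_upwards [hev] with p hp using (key p hp).2
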